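/- Let H be an elementary abelian 2-hypergroup and G a closed subset of H. Then Thin(G) = O_ϑ(G), the group O_ϑ(G)^γ is an elementary abelian 2-group of 2-rank r_2(G), and |Thin(G)| = |O_ϑ(G)| = 2^{r_2(G)}. -/

import Mathlib

namespace HyperPaper

/-- A hypergroup: hypermultiplication `hmul`, inversion `star`, identity `e`,
satisfying (H1) associativity, (H2) unique two-sided identity, (H3) exchange conditions. -/
structure Hypergroup (H : Type*) where
  hmul : H → H → Set H
  star : H → H
  e : H
  idl : ∀ p, hmul e p = {p}
  idr : ∀ p, hmul p e = {p}
  e_unique : ∀ e' : H, (∀ p, hmul e' p = {p} ∧ hmul p e' = {p}) → e' = e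
  assoc : ∀ p q r : H, (⋃ x ∈ hmul p q, hmul x r) = ⋃ x ∈ hmul q r, hmul p x
  h3l : ∀ p q r : H, p ∈ hmul q r ↔ q ∈ hmul p (star r)
  h3r : ∀ p q r : H, p ∈ hmul q r ↔ r ∈ hmul (star q) p

variable {H : Type*}

namespace Hypergroup

/-- Product of two subsets: FG = {a : ∃ b ∈ F, c ∈ G, a ∈ bc}. -/
def smul (hg : Hypergroup H) (F G : Set H) : Set H :=
  {a | ∃ b ∈ F, ∃ c ∈ G, a ∈ hg.hmul b c}

/-- Closed subset: nonempty and G*G ⊆ G. -/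
def IsClosed (hg : Hypergroup H) (G : Set H) : Prop :=
  G.Nonempty ∧ hg.smul (hg.star '' G) G ⊆ G

/-- Thin element: p*p = {e}. -/
def IsThin (hg : Hypergroup H) (p : H) : Prop := hg.hmul (hg.star p) p = {hg.e}

/-- Thick element: not thin. -/
def IsThick (hg : Hypergroup H) (p : H) : Prop := ¬ hg.IsThin p

/-- Involution: p ≠ e and {e, p} is closed. -/
def IsInvolution (hg : Hypergroup H) (p : H) : Prop :=
  p ≠ hg.e ∧ hg.IsClosed {hg.e, p}

/-- ⟨G⟩: smallest closed subset containing G. -/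
def gen (hg : Hypergroup H) (G : Set H) : Set H := ⋂₀ {C | hg.IsClosed C ∧ G ⊆ C}

/-- O_ϑ(G): the thin elements of H lying in G. -/
def Othin (hg : Hypergroup H) (G : Set H) : Set H := {p ∈ G | hg.IsThin p}

/-- F is a strongly normal closed subset of G: p*Fp ⊆ F ⊆ G for all p ∈ G. -/
def IsStronglyNormal (hg : Hypergroup H) (F G : Set H) : Prop :=
  hg.IsClosed F ∧ hg.IsClosed G ∧ F ⊆ G ∧
    ∀ p ∈ G, hg.smul (hg.smul {hg.star p} F) {p} ⊆ F

/-- O^ϑ(G): intersection of all strongly normal closed subsets of ⟨G⟩. -/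
def Osup (hg : Hypergroup H) (G : Set H) : Set H :=
  ⋂₀ {F | hg.IsStronglyNormal F (hg.gen G)}

/-- F is a normal closed subset of G. -/
def IsNormal (hg : Hypergroup H) (F G : Set H) : Prop :=
  hg.IsClosed F ∧ hg.IsClosed G ∧ F ⊆ G ∧ ∀ p ∈ G, hg.smul F {p} = hg.smul {p} F

/-- Product of a list of subsets (empty product is {e}). -/
def listProd (hg : Hypergroup H) : List (Set H) → Set H
  | [] => {hg.e}
  | a :: l => hg.smul a (hg.listProd l)

/-- Product r_1 r_2 ⋯ r_n of a family of elements. -/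
def famProd (hg : Hypergroup H) {n : ℕ} (r : Fin n → H) : Set H :=
  hg.listProd ((List.finRange n).map fun i => ({r i} : Set H))

/-- Ĝ_i: the product of the G_j with j ≠ i. -/
def cofactor (hg : Hypergroup H) {n : ℕ} (G : Fin n → Set H) (i : Fin n) : Set H :=
  hg.listProd (((List.finRange n).filter fun j => decide (j ≠ i)).map G)

/-- H is the direct product of the normal closed subsets G_1, …, G_n. -/
def IsDirectProduct (hg : Hypergroup H) {n : ℕ} (G : Fin n → Set H) : Prop :=
  (∀ i, hg.IsNormal (G i) Set.univ) ∧
  (∀ i, hg.smul (G i) (hg.cofactor G i) = Set.univ) ∧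
  (∀ i, G i ∩ hg.cofactor G i = {hg.e})

/-- r : Fin n → H is a decomposition of x with respect to the family G. -/
def IsDecomp (hg : Hypergroup H) {n : ℕ} (G : Fin n → Set H) (x : H) (r : Fin n → H) : Prop :=
  (∀ i, r i ∈ G i) ∧ x ∈ hg.famProd r

/-- The support of x: the elements ≠ e appearing in the decomposition of x. -/
def dsupport (hg : Hypergroup H) {n : ℕ} (G : Fin n → Set H) (x : H) : Set H :=
  {y | y ≠ hg.e ∧ ∃ r, hg.IsDecomp G x r ∧ y ∈ Set.range r}

/-- The cover of x: the product r_1r_2⋯r_n for the decomposition of x. -/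
def dcover (hg : Hypergroup H) {n : ℕ} (G : Fin n → Set H) (x : H) : Set H :=
  {y | ∃ r, hg.IsDecomp G x r ∧ y ∈ hg.famProd r}

/-- x is constrained: its cover equals {x}. -/
def IsConstrained (hg : Hypergroup H) {n : ℕ} (G : Fin n → Set H) (x : H) : Prop :=
  hg.dcover G x = {x}

/-- r_2(G): the largest 2-rank of a thin closed subset of H contained in G
(equivalently, the largest k such that G contains a thin symmetric closed subset
of 2^k elements, which corresponds to an elementary abelian 2-group of 2-rank k). -/
noncomputable def rank2 (hg : Hypergroup H) (G : Set H) : ℕ :=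
  sSup {k | ∃ U : Set H, hg.IsClosed U ∧ U ⊆ G ∧ (∀ u ∈ U, hg.IsThin u) ∧
    (∀ u ∈ U, hg.star u = u) ∧ U.ncard = 2 ^ k}

/-- F is a minimal generating subset of G. -/
def IsMinGen (hg : Hypergroup H) (G F : Set H) : Prop :=
  F ⊆ G ∧ hg.gen F = G ∧ ∀ p ∈ F, hg.gen (F \ {p}) ≠ G

/-- The dimension of G: the smallest cardinality of a minimal generating subset. -/
noncomputable def dimension (hg : Hypergroup H) (G : Set H) : ℕ :=
  sInf {k | ∃ F : Set H, hg.IsMinGen G F ∧ F.Finite ∧ F.ncard = k}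

/-- [F, G] = ⟨{a : ∃ b ∈ F, c ∈ G, a ∈ b*c*bc}⟩. -/
def commSet (hg : Hypergroup H) (F G : Set H) : Set H :=
  hg.gen {a | ∃ b ∈ F, ∃ c ∈ G,
    a ∈ hg.smul (hg.smul (hg.smul {hg.star b} {hg.star c}) {b}) {c}}

/-- derived G k = G^{(k+1)}: G^{(1)} = G, G^{(r)} = [G^{(r-1)}, G]. -/
def derived (hg : Hypergroup H) (G : Set H) : ℕ → Set H
  | 0 => G
  | k + 1 => hg.commSet (hg.derived G k) G

/-- G is nilpotent: G^{(r)} = {e} for some r. -/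
def IsNilpotent (hg : Hypergroup H) (G : Set H) : Prop :=
  ∃ k : ℕ, hg.derived G k = {hg.e}

/-- G is a residually thin closed subset: there is a chain {e} = F_1, …, F_n = G of
pairwise distinct closed subsets, each strongly normal in the next. -/
def IsResiduallyThin (hg : Hypergroup H) (G : Set H) : Prop :=
  ∃ (m : ℕ) (F : Fin (m + 1) → Set H), Function.Injective F ∧
    F 0 = {hg.e} ∧ F (Fin.last m) = G ∧
    ∀ i : Fin m, hg.IsStronglyNormal (F i.castSucc) (F i.succ)

/-- x^k as a subset: x^0 = {e}, x^{k+1} = x^k · x. -/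
def spow (hg : Hypergroup H) (x : H) : ℕ → Set H
  | 0 => {hg.e}
  | k + 1 => hg.smul (hg.spow x k) {x}

/-- F is a maximal closed subset of G. -/
def IsMaximalClosed (hg : Hypergroup H) (F G : Set H) : Prop :=
  hg.IsClosed F ∧ hg.IsClosed G ∧ F ⊆ G ∧ F ≠ G ∧
    ∀ E : Set H, hg.IsClosed E → F ⊆ E → E ⊆ G → E = F ∨ E = G

/-- The Frattini closed subset of G: the intersection (inside G) of all maximal
closed subsets of G. -/
def frattini (hg : Hypergroup H) (G : Set H) : Set H :=
  G ∩ ⋂₀ {F | hg.IsMaximalClosed F G}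

/-- α is an isomorphism from the closed subset F to the closed subset G. -/
def IsIso (hg : Hypergroup H) (F G : Set H) (α : H → H) : Prop :=
  Set.BijOn α F G ∧ α hg.e = hg.e ∧
    ∀ p ∈ F, ∀ q ∈ F, α '' hg.hmul p q = hg.hmul (α p) (α q)

/-- F ≃ G: there is an isomorphism from F to G. -/
def Isomorphic (hg : Hypergroup H) (F G : Set H) : Prop := ∃ α : H → H, hg.IsIso F G α

/-- Aut(G): the automorphism group of G, realized as the subgroup of permutations of G
that fix e and preserve the hypermultiplication. -/
def autGroup (hg : Hypergroup H) (G : Set H) : Subgroup (Equiv.Perm G) where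
  carrier := {σ | (∀ x : G, (x : H) = hg.e → ((σ x : H)) = hg.e) ∧
    ∀ p q x : G, (x : H) ∈ hg.hmul p q ↔ ((σ x : H)) ∈ hg.hmul (σ p) (σ q)}
  one_mem' := by
    constructor
    · intro x hx; simpa using hx
    · intro p q x; simp
  mul_mem' := by
    rintro σ τ ⟨he1, hm1⟩ ⟨he2, hm2⟩
    refine ⟨fun x hx => ?_, fun p q x => ?_⟩
    · simpa using he1 _ (he2 x hx)
    · simpa using (hm2 p q x).trans (hm1 (τ p) (τ q) (τ x))
  inv_mem' := by
    rintro σ ⟨he, hm⟩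
    refine ⟨fun x hx => ?_, fun p q x => ?_⟩
    · have h2 : σ x = x := Subtype.ext ((he x hx).trans hx.symm)
      have h3 : σ⁻¹ x = x := by
        conv_lhs => rw [← h2]
        simp
      rw [h3]; exact hx
    · have h := hm (σ⁻¹ p) (σ⁻¹ q) (σ⁻¹ x)
      simpa using h.symm

end Hypergroup

/-- An elementary abelian 2-hypergroup: a hypergroup that is the constrained direct
product of the closed subsets ⟨q_1⟩, …, ⟨q_n⟩ generated by involutions q_1, …, q_n. -/
structure EA2Data (H : Type*) where
  hg : Hypergroup H
  n : ℕ
  q : Fin n → H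
  invol : ∀ i, hg.IsInvolution (q i)
  dp : hg.IsDirectProduct fun i => hg.gen {q i}
  constrained : ∀ x : H, hg.IsConstrained (fun i => hg.gen {q i}) x

namespace EA2Data

/-- The family ⟨q_1⟩, …, ⟨q_n⟩. -/
def fam (E : EA2Data H) : Fin E.n → Set H := fun i => E.hg.gen {E.q i}

/-- The support of x. -/
def support (E : EA2Data H) (x : H) : Set H := E.hg.dsupport E.fam x

/-- Thick(F): externally thick elements of H lying in F. -/
def ThickIn (E : EA2Data H) (F : Set H) : Set H :=
  {x ∈ F | x = E.hg.e ∨ ∀ y ∈ E.support x, E.hg.IsThick y}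

/-- Thin(F): externally thin elements of H lying in F. -/
def ThinIn (E : EA2Data H) (F : Set H) : Set H :=
  {x ∈ F | x = E.hg.e ∨ ∀ y ∈ E.support x, E.hg.IsThin y}

/-- The (unique) pair (x⁺, x⁻) with x⁺ ∈ Thick(H), x⁻ ∈ Thin(H), x⁺x⁻ = {x}. -/
noncomputable def pm (E : EA2Data H) (x : H) : H × H :=
  @Classical.epsilon (H × H) ⟨(E.hg.e, E.hg.e)⟩ fun z =>
    z.1 ∈ E.ThickIn Set.univ ∧ z.2 ∈ E.ThinIn Set.univ ∧ E.hg.hmul z.1 z.2 = {x}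

/-- x⁺. -/
noncomputable def plus (E : EA2Data H) (x : H) : H := (E.pm x).1

/-- x⁻. -/
noncomputable def minus (E : EA2Data H) (x : H) : H := (E.pm x).2

/-- s(x): the number of thick elements of H in the support of x. -/
noncomputable def sElem (E : EA2Data H) (x : H) : ℕ :=
  {y ∈ E.support x | E.hg.IsThick y}.ncard

/-- s(G) = max {s(a) : a ∈ G}. -/
noncomputable def sSet (E : EA2Data H) (G : Set H) : ℕ :=
  sSup {k | ∃ a ∈ G, E.sElem a = k}

/-- x ⪯ y: the support of x is contained in the support of y. -/
def ple (E : EA2Data H) (x y : H) : Prop := E.support x ⊆ E.support y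

/-- p♯: the number of thick elements among q_1, …, q_n. -/
noncomputable def psharp (E : EA2Data H) : ℕ := {i : Fin E.n | E.hg.IsThick (E.q i)}.ncard

end EA2Data

/-- The Gaussian binomial coefficient C(n, k)_2 with base 2, via the
q-Pascal recurrence C(n, k)_2 = C(n-1, k-1)_2 + 2^k · C(n-1, k)_2. -/
def gaussBinom2 : ℕ → ℕ → ℕ
  | _, 0 => 1
  | 0, _ + 1 => 0
  | n + 1, k + 1 => gaussBinom2 n k + 2 ^ (k + 1) * gaussBinom2 n (k + 1)

end HyperPaper

namespace HyperPaper

namespace Hypergroup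

section Basic

variable {H : Type*} (hg : Hypergroup H)

theorem e_mem_star_mul (p : H) : hg.e ∈ hg.hmul (hg.star p) p :=
  (hg.h3r p p hg.e).1 (by simp [hg.idr])

theorem star_star (p : H) : hg.star (hg.star p) = p := by
  have h := (hg.h3r _ _ _).1 (hg.e_mem_star_mul p)
  rw [hg.idr] at h
  exact h.symm

theorem star_e : hg.star hg.e = hg.e := by
  have h := hg.e_mem_star_mul hg.e
  rw [hg.idr] at h
  exact h.symm

theorem star_mem_hmul {x q r : H} (h : x ∈ hg.hmul q r) :
    hg.star x ∈ hg.hmul (hg.star r) (hg.star q) :=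
  (hg.h3r _ _ _).1 ((hg.h3l _ _ _).1 ((hg.h3r _ _ _).1 h))

theorem isThin_e : hg.IsThin hg.e := by
  rw [IsThin, hg.star_e, hg.idl]

/-- The sets of elements of a hypergroup form a monoid under the complex product. -/
abbrev setMonoid : Monoid (Set H) where
  mul := hg.smul
  one := {hg.e}
  mul_assoc A B C := by
    ext x
    constructor
    · rintro ⟨u, ⟨a, ha, b, hb, hu⟩, c, hc, hx⟩
      have h : x ∈ ⋃ y ∈ hg.hmul a b, hg.hmul y c := Set.mem_biUnion hu hx
      rw [hg.assoc] at h
      obtain ⟨v, hv, hx'⟩ := Set.mem_iUnion₂.1 h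
      exact ⟨a, ha, v, ⟨b, hb, c, hc, hv⟩, hx'⟩
    · rintro ⟨a, ha, v, ⟨b, hb, c, hc, hv⟩, hx⟩
      have h : x ∈ ⋃ y ∈ hg.hmul b c, hg.hmul a y := Set.mem_biUnion hv hx
      rw [← hg.assoc] at h
      obtain ⟨u, hu, hx'⟩ := Set.mem_iUnion₂.1 h
      exact ⟨u, ⟨a, ha, b, hb, hu⟩, c, hc, hx'⟩
  one_mul A := by
    ext x
    constructor
    · rintro ⟨a, rfl, b, hb, hx⟩
      rw [hg.idl] at hx
      exact hx ▸ hb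
    · exact fun hx => ⟨hg.e, rfl, x, hx, by simp [hg.idl]⟩
  mul_one A := by
    ext x
    constructor
    · rintro ⟨a, ha, b, rfl, hx⟩
      rw [hg.idr] at hx
      exact hx ▸ ha
    · exact fun hx => ⟨x, hx, hg.e, rfl, by simp [hg.idr]⟩

theorem listProd_eq_prod (l : List (Set H)) :
    hg.listProd l = @List.prod _ hg.setMonoid.toMul hg.setMonoid.toOne l := by
  let := hg.setMonoid
  induction l with
  | nil => rfl
  | cons a l ih => rw [List.prod_cons, ← ih]; rfl

theorem smul_assoc (A B C : Set H) :
    hg.smul (hg.smul A B) C = hg.smul A (hg.smul B C) :=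
  hg.setMonoid.mul_assoc A B C

theorem e_smul (A : Set H) : hg.smul {hg.e} A = A := hg.setMonoid.one_mul A

theorem smul_e (A : Set H) : hg.smul A {hg.e} = A := hg.setMonoid.mul_one A

theorem singleton_smul_singleton (p q : H) : hg.smul {p} {q} = hg.hmul p q := by
  ext x
  simp [smul]

theorem smul_mono {A B C D : Set H} (h : A ⊆ B) (h' : C ⊆ D) : hg.smul A C ⊆ hg.smul B D := by
  rintro x ⟨a, ha, c, hc, hx⟩
  exact ⟨a, h ha, c, h' hc, hx⟩

theorem e_mem_listProd {l : List (Set H)} (h : ∀ A ∈ l, hg.e ∈ A) : hg.e ∈ hg.listProd l := by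
  induction l with
  | nil => rfl
  | cons A l ih =>
    simp only [List.forall_mem_cons] at h
    exact ⟨hg.e, h.1, hg.e, ih h.2, by simp [hg.idl]⟩

theorem subset_listProd {l : List (Set H)} (h : ∀ A ∈ l, hg.e ∈ A) {B : Set H} (hB : B ∈ l) :
    B ⊆ hg.listProd l := by
  induction l with
  | nil => simp at hB
  | cons A l ih =>
    simp only [List.forall_mem_cons] at h
    rcases List.mem_cons.1 hB with rfl | hB
    · exact fun x hx => ⟨x, hx, hg.e, hg.e_mem_listProd h.2, by simp [hg.idr]⟩
    · exact fun x hx => ⟨hg.e, h.1, x, ih h.2 hB hx, by simp [hg.idl]⟩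

theorem star_mem_listProd {l : List H} {x : H} (h : x ∈ hg.listProd (l.map fun a => {a})) :
    hg.star x ∈ hg.listProd ((l.map fun a => ({hg.star a} : Set H)).reverse) := by
  let := hg.setMonoid
  rw [listProd_eq_prod] at h ⊢
  induction l generalizing x with
  | nil =>
    rw [show x = hg.e from h, star_e]
    rfl
  | cons a l ih =>
    rw [List.map_cons, List.prod_cons] at h
    obtain ⟨b, rfl, c, hc, hx⟩ := h
    rw [List.map_cons, List.reverse_cons, List.prod_append, List.prod_singleton]
    exact ⟨hg.star c, ih hc, hg.star b, rfl, hg.star_mem_hmul hx⟩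

variable {hg} {G : Set H}

theorem IsClosed.e_mem (hG : hg.IsClosed G) : hg.e ∈ G := by
  obtain ⟨⟨a, ha⟩, h⟩ := hG
  exact h ⟨hg.star a, ⟨a, ha, rfl⟩, a, ha, hg.e_mem_star_mul a⟩

theorem IsClosed.star_mem (hG : hg.IsClosed G) {a : H} (ha : a ∈ G) : hg.star a ∈ G :=
  hG.2 ⟨hg.star a, ⟨a, ha, rfl⟩, hg.e, hG.e_mem, by simp [hg.idr]⟩

theorem IsClosed.hmul_subset (hG : hg.IsClosed G) {a b : H} (ha : a ∈ G) (hb : b ∈ G) :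
    hg.hmul a b ⊆ G := fun _ hx =>
  hG.2 ⟨a, ⟨hg.star a, hG.star_mem ha, hg.star_star a⟩, b, hb, hx⟩

theorem IsInvolution.star_eq {q : H} (hq : hg.IsInvolution q) : hg.star q = q := by
  rcases hq.2.star_mem (a := q) (by simp) with h | h
  · exact absurd (by rw [← hg.star_star q, h, hg.star_e]) hq.1
  · exact h

theorem IsInvolution.gen_eq {q : H} (hq : hg.IsInvolution q) : hg.gen {q} = {hg.e, q} := by
  apply Set.Subset.antisymm
  · exact Set.sInter_subset_of_mem ⟨hq.2, by simp⟩
  · rintro x (rfl | rfl)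
    · exact Set.mem_sInter.2 fun C hC => hC.1.e_mem
    · exact Set.mem_sInter.2 fun C hC => hC.2 rfl

theorem IsInvolution.hmul_self {q : H} (hq : hg.IsInvolution q) (ht : ¬ hg.IsThin q) :
    q ∈ hg.hmul q q := by
  by_contra h
  refine ht ?_
  rw [IsThin]
  refine Set.Subset.antisymm (fun x hx => ?_) (by simpa using hg.e_mem_star_mul q)
  rw [hq.star_eq] at hx
  rcases hq.2.hmul_subset (by simp) (by simp) hx with rfl | rfl
  · rfl
  · exact absurd hx h

theorem IsThin.eq_of_mem {p q z : H} (hp : hg.IsThin p) (hz : z ∈ hg.hmul (hg.star p) q) :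
    hg.hmul (hg.star p) q = {z} := by
  refine Set.Subset.antisymm (fun w hw => ?_) (by simpa using hz)
  have h : q ∈ hg.hmul p z := by simpa [hg.star_star] using (hg.h3r _ _ _).1 hz
  have h' : w ∈ hg.smul {hg.star p} (hg.smul {p} {z}) :=
    ⟨_, rfl, q, by rwa [singleton_smul_singleton], hw⟩
  rw [← smul_assoc, singleton_smul_singleton, hp, e_smul] at h'
  exact h'

variable (hg) in
theorem hmul_nonempty (p q : H) : (hg.hmul p q).Nonempty := by
  have h : q ∈ hg.smul (hg.smul {hg.star p} {p}) {q} := by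
    rw [singleton_smul_singleton]
    exact ⟨hg.e, hg.e_mem_star_mul p, q, rfl, by simp [hg.idl]⟩
  rw [smul_assoc] at h
  obtain ⟨_, -, c, hc, -⟩ := h
  exact ⟨c, by rwa [singleton_smul_singleton] at hc⟩

theorem IsThin.of_mem {p q z : H} (hp : hg.IsThin p) (hq : hg.IsThin q)
    (hz : z ∈ hg.hmul p q) : hg.IsThin z := by
  rw [IsThin]
  refine Set.Subset.antisymm (fun w hw => ?_) (by simpa using hg.e_mem_star_mul z)
  have h : w ∈ hg.smul (hg.smul {hg.star q} {hg.star p}) (hg.smul {p} {q}) := by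
    rw [singleton_smul_singleton, singleton_smul_singleton]
    exact ⟨_, hg.star_mem_hmul hz, z, hz, hw⟩
  rw [smul_assoc, ← hg.smul_assoc {hg.star p}, hg.singleton_smul_singleton _ p, hp, e_smul,
    singleton_smul_singleton, hq] at h
  exact h

theorem isThin_of_mem_listProd {l : List H} (hl : ∀ a ∈ l, hg.IsThin a) {x : H}
    (hx : x ∈ hg.listProd (l.map fun a => {a})) : hg.IsThin x := by
  induction l generalizing x with
  | nil =>
    rw [show x = hg.e from hx]
    exact hg.isThin_e
  | cons a l ih =>
    simp only [List.forall_mem_cons] at hl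
    obtain ⟨b, rfl, c, hc, hx⟩ := hx
    exact hl.1.of_mem (ih hl.2 hc) hx

end Basic

section SymmetricThin

variable {H : Type*} {hg : Hypergroup H} {U : Set H}

/-- The singletons of a symmetric thin closed subset, as a submonoid of the complex monoid. -/
def thinSubmonoid (hU : hg.IsClosed U) (ht : ∀ u ∈ U, hg.IsThin u)
    (hs : ∀ u ∈ U, hg.star u = u) : @Submonoid (Set H) hg.setMonoid.toMulOneClass :=
  letI := hg.setMonoid
  { carrier := (fun u => ({u} : Set H)) '' U
    one_mem' := ⟨hg.e, hU.e_mem, rfl⟩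
    mul_mem' := by
      rintro _ _ ⟨u, hu, rfl⟩ ⟨v, hv, rfl⟩
      obtain ⟨z, hz⟩ := hg.hmul_nonempty u v
      refine ⟨z, hU.hmul_subset hu hv hz, ?_⟩
      change {z} = hg.smul {u} {v}
      rw [singleton_smul_singleton]
      have h := (ht u hu).eq_of_mem (q := v) (z := z) (by rwa [hs u hu])
      rw [hs u hu] at h
      exact h.symm }

theorem exists_ncard_eq_two_pow (hU : hg.IsClosed U) (ht : ∀ u ∈ U, hg.IsThin u)
    (hs : ∀ u ∈ U, hg.star u = u) (hfin : U.Finite) : ∃ k, U.ncard = 2 ^ k := by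
  let := hg.setMonoid
  let S := thinSubmonoid hU ht hs
  have hsq : ∀ a : S, a * a = 1 := by
    rintro ⟨_, u, hu, rfl⟩
    apply Subtype.ext
    change hg.smul {u} {u} = {hg.e}
    rw [singleton_smul_singleton]
    have h := ht u hu
    rwa [IsThin, hs u hu] at h
  let : Group S :=
    { (inferInstance : Monoid S) with
      inv := id
      inv_mul_cancel := hsq }
  have hSfin : ((fun u => ({u} : Set H)) '' U).Finite := hfin.image _
  have : Finite S := hSfin
  have hp : IsPGroup 2 S := fun a => ⟨1, by rw [pow_one, pow_two]; exact hsq a⟩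
  obtain ⟨k, hk⟩ := IsPGroup.iff_card.1 hp
  refine ⟨k, ?_⟩
  rw [← hk, ← Set.ncard_image_of_injective U Set.singleton_injective]
  exact (Nat.card_coe_set_eq _).symm

end SymmetricThin

end Hypergroup

namespace EA2Data

open Hypergroup

variable {H : Type*} (E : EA2Data H)

theorem fam_eq (i : Fin E.n) : E.hg.gen {E.q i} = {E.hg.e, E.q i} := (E.invol i).gen_eq

theorem exists_decomp (x : H) :
    ∃ r : Fin E.n → H, (∀ i, r i = E.hg.e ∨ r i = E.q i) ∧ E.hg.famProd r = {x} := by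
  have hx : x ∈ E.hg.dcover (fun i => E.hg.gen {E.q i}) x := by
    rw [E.constrained x]; rfl
  obtain ⟨r, hr, -⟩ := hx
  refine ⟨r, fun i => by simpa [E.fam_eq] using hr.1 i, ?_⟩
  refine Set.Subset.antisymm (fun y hy => ?_) (by simpa using hr.2)
  rw [← E.constrained x]
  exact ⟨r, hr, hy⟩

theorem famProd_eq {x : H} {r : Fin E.n → H} (hr : E.hg.IsDecomp E.fam x r) :
    E.hg.famProd r = {x} := by
  refine Set.Subset.antisymm (fun y hy => ?_) (by simpa using hr.2)
  rw [← E.constrained x]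
  exact ⟨r, hr, hy⟩

theorem q_ne_of_ne {i j : Fin E.n} (hij : i ≠ j) : E.q i ∉ ({E.hg.e, E.q j} : Set H) := by
  intro h
  refine (E.invol i).1 ?_
  have h' : E.q i ∈ E.hg.gen {E.q i} ∩ E.hg.cofactor (fun i => E.hg.gen {E.q i}) i := by
    refine ⟨by simp [E.fam_eq], E.hg.subset_listProd ?_ (B := E.hg.gen {E.q j}) ?_ ?_⟩
    · simp +contextual [E.fam_eq]
    · exact List.mem_map.2 ⟨j, by simp [hij.symm], rfl⟩
    · rwa [E.fam_eq]
  rw [E.dp.2.2 i] at h'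
  exact h'

theorem hmul_q_subset {i j : Fin E.n} (hij : i ≠ j) :
    E.hg.hmul (E.q i) (E.q j) ⊆ E.hg.hmul (E.q j) (E.q i) := by
  intro x hx
  have hn := (E.dp.1 i).2.2.2 (E.q j) (Set.mem_univ _)
  simp only [E.fam_eq] at hn
  have h : x ∈ E.hg.smul {E.hg.e, E.q i} {E.q j} := ⟨_, by simp, _, rfl, hx⟩
  rw [hn] at h
  obtain ⟨_, rfl, c, rfl | rfl, hc⟩ := h
  · rw [E.hg.idr] at hc
    obtain rfl : x = E.q j := hc
    have h := (E.hg.h3l _ _ _).1 hx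
    rw [(E.invol j).star_eq] at h
    exact absurd ((E.invol j).2.hmul_subset (by simp) (by simp) h) (E.q_ne_of_ne hij)
  · exact hc

theorem pairwise_commute {r : Fin E.n → H} (hr : ∀ i, r i = E.hg.e ∨ r i = E.q i)
    (i j : Fin E.n) : E.hg.smul {r i} {r j} = E.hg.smul {r j} {r i} := by
  rcases hr i with hi | hi
  · rw [hi, e_smul, smul_e]
  rcases hr j with hj | hj
  · rw [hj, e_smul, smul_e]
  rcases eq_or_ne i j with rfl | hij
  · rfl
  · rw [hi, hj, singleton_smul_singleton, singleton_smul_singleton]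
    exact (E.hmul_q_subset hij).antisymm (E.hmul_q_subset hij.symm)

theorem listProd_perm {r : Fin E.n → H} (hr : ∀ i, r i = E.hg.e ∨ r i = E.q i)
    {l : List (Fin E.n)} {m : List (Set H)} (h : (l.map fun i => ({r i} : Set H)).Perm m) :
    E.hg.listProd (l.map fun i => ({r i} : Set H)) = E.hg.listProd m := by
  let := E.hg.setMonoid
  rw [listProd_eq_prod, listProd_eq_prod]
  refine h.prod_eq' (List.pairwise_map.2 (List.pairwise_of_forall fun i j => ?_))
  exact E.pairwise_commute hr i j

theorem star_eq (x : H) : E.hg.star x = x := by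
  obtain ⟨r, hr, hx⟩ := E.exists_decomp x
  have hs : ∀ i, E.hg.star (r i) = r i := fun i => by
    rcases hr i with h | h <;> rw [h]
    exacts [E.hg.star_e, (E.invol i).star_eq]
  have h : x ∈ E.hg.famProd r := by rw [hx]; rfl
  have h' := E.hg.star_mem_listProd (l := (List.finRange E.n).map r)
    (by rw [List.map_map]; exact h)
  rw [List.map_map, show ((fun a => ({E.hg.star a} : Set H)) ∘ r) = fun i => {r i} from
    funext fun i => by simp [hs], ← E.listProd_perm hr (List.reverse_perm _).symm] at h'
  change _ ∈ E.hg.famProd r at h'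
  rw [hx] at h'
  exact h'

theorem exists_famProd_eq_smul {r : Fin E.n → H} (hr : ∀ i, r i = E.hg.e ∨ r i = E.q i)
    (i : Fin E.n) : ∃ A, E.hg.famProd r = E.hg.smul A {r i} := by
  let := E.hg.setMonoid
  have hp : (List.finRange E.n).Perm ((List.finRange E.n).erase i ++ [i]) :=
    (List.perm_cons_erase (List.mem_finRange i)).trans (List.perm_append_singleton _ _).symm
  refine ⟨E.hg.listProd (((List.finRange E.n).erase i).map fun j => {r j}), ?_⟩
  rw [famProd, E.listProd_perm hr (hp.map _), listProd_eq_prod, listProd_eq_prod,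
    List.map_append, List.prod_append, List.map_singleton, List.prod_singleton]
  rfl

theorem isThin_of_decomp {x : H} (hx : E.hg.IsThin x) {r : Fin E.n → H}
    (hr : E.hg.IsDecomp E.fam x r) (i : Fin E.n) (hi : r i ≠ E.hg.e) : E.hg.IsThin (r i) := by
  have hr' : ∀ i, r i = E.hg.e ∨ r i = E.q i := fun i => by
    simpa [fam, E.fam_eq] using hr.1 i
  have hq : r i = E.q i := (hr' i).resolve_left hi
  by_contra ht
  rw [hq] at ht
  obtain ⟨A, hA⟩ := E.exists_famProd_eq_smul hr' i
  rw [E.famProd_eq hr, hq] at hA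
  have hmem : x ∈ E.hg.smul {x} {E.q i} := by
    have h : x ∈ E.hg.smul A {E.q i} := by rw [← hA]; rfl
    rw [hA, smul_assoc, singleton_smul_singleton]
    exact E.hg.smul_mono subset_rfl
      (Set.singleton_subset_iff.2 ((E.invol i).hmul_self ht)) h
  rw [singleton_smul_singleton] at hmem
  have h := (E.hg.h3r _ _ _).1 hmem
  rw [hx] at h
  exact (E.invol i).1 h

theorem thinIn_eq_Othin (G : Set H) : E.ThinIn G = E.hg.Othin G := by
  ext x
  refine and_congr_right fun _ => ⟨?_, fun hx => Or.inr ?_⟩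
  · rintro (rfl | h)
    · exact E.hg.isThin_e
    · obtain ⟨r, hr, hx⟩ := E.exists_decomp x
      have hmem : x ∈ E.hg.famProd r := by rw [hx]; rfl
      refine isThin_of_mem_listProd (l := (List.finRange E.n).map r) ?_
        (by rw [List.map_map]; exact hmem)
      intro a ha
      obtain ⟨i, -, rfl⟩ := List.mem_map.1 ha
      by_cases hi : r i = E.hg.e
      · rw [hi]; exact E.hg.isThin_e
      · exact h _ ⟨hi, r, ⟨fun j => by simpa [fam, E.fam_eq] using hr j, hmem⟩, i, rfl⟩
  · rintro _ ⟨hy, r, hr, i, rfl⟩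
    exact E.isThin_of_decomp hx hr i hy

theorem finite (E : EA2Data H) : Finite H := by
  choose r hr hx using E.exists_decomp
  have hf : Function.Injective fun x => {i | r x i = E.q i} := by
    intro x y h
    have hxy : r x = r y := by
      funext i
      have h' := Set.ext_iff.1 h i
      simp only [Set.mem_ofPred_eq] at h'
      by_cases hi : r x i = E.q i
      · rw [hi, h'.1 hi]
      · rw [(hr x i).resolve_right hi, (hr y i).resolve_right fun h => hi (h'.2 h)]
    have := hx x
    rw [hxy, hx y] at this
    exact (Set.singleton_injective this).symm
  exact Finite.of_injective _ hf

theorem isClosed_Othin {G : Set H} (hG : E.hg.IsClosed G) : E.hg.IsClosed (E.hg.Othin G) := by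
  refine ⟨⟨_, hG.e_mem, E.hg.isThin_e⟩, ?_⟩
  rintro x ⟨_, ⟨a, ha, rfl⟩, b, hb, hx⟩
  rw [E.star_eq] at hx
  exact ⟨hG.hmul_subset ha.1 hb.1 hx, ha.2.of_mem hb.2 hx⟩

theorem ncard_Othin {G : Set H} (hG : E.hg.IsClosed G) :
    (E.hg.Othin G).ncard = 2 ^ E.hg.rank2 G := by
  have := E.finite
  obtain ⟨k, hk⟩ := exists_ncard_eq_two_pow (E.isClosed_Othin hG) (fun u hu => hu.2)
    (fun u _ => E.star_eq u) (Set.toFinite _)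
  have hmax : IsGreatest {k | ∃ U : Set H, E.hg.IsClosed U ∧ U ⊆ G ∧ (∀ u ∈ U, E.hg.IsThin u) ∧
      (∀ u ∈ U, E.hg.star u = u) ∧ U.ncard = 2 ^ k} k := by
    refine ⟨⟨_, E.isClosed_Othin hG, fun u hu => hu.1, fun u hu => hu.2,
      fun u _ => E.star_eq u, hk⟩, ?_⟩
    rintro m ⟨U, -, hUG, hU, -, hm⟩
    have h : U.ncard ≤ (E.hg.Othin G).ncard :=
      Set.ncard_le_ncard (fun u hu => ⟨hUG hu, hU u hu⟩) (Set.toFinite _)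
    rw [hm, hk] at h
    exact (Nat.pow_le_pow_iff_right (by norm_num)).1 h
  rw [hk, rank2, hmax.csSup_eq]

end EA2Data

end HyperPaper

open HyperPaper

/-- For a closed subset G of an elementary abelian 2-hypergroup:
Thin(G) = O_ϑ(G); the group O_ϑ(G)^γ is an elementary abelian 2-group of 2-rank r_2(G)
(i.e. O_ϑ(G) is a thin closed subset, all of whose elements are symmetric, with
2^{r_2(G)} elements); and |Thin(G)| = |O_ϑ(G)| = 2^{r_2(G)}. -/
theorem stmt6 {H : Type*} (E : EA2Data H) (G : Set H) (hG : E.hg.IsClosed G) :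
    E.ThinIn G = E.hg.Othin G ∧
      E.hg.IsClosed (E.hg.Othin G) ∧
      (∀ u ∈ E.hg.Othin G, E.hg.IsThin u) ∧
      (∀ u ∈ E.hg.Othin G, E.hg.star u = u) ∧
      (E.ThinIn G).ncard = (E.hg.Othin G).ncard ∧
      (E.hg.Othin G).ncard = 2 ^ E.hg.rank2 G := by
  exact ⟨E.thinIn_eq_Othin G, E.isClosed_Othin hG, fun u hu => hu.2, fun u _ => E.star_eq u,
    by rw [E.thinIn_eq_Othin], E.ncard_Othin hG⟩
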